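/- arXiv:1304.5150 — 4 statements merged into one kernel-verified Lean document; each statement's English description precedes it below -/
import Mathlib

section
/- Let μ and ν be Borel probability measures on [0,1] such that Λ_μ(z) ≤ Λ_ν(z) for every z ∈ [0,1]. Then ∫ √(1-x²) dμ(x) ≤ ∫ √(1-x²) dν(x); that is, a degraded channel has larger Battacharyya parameter than the original channel. -/
open MeasureTheory Real Set

/-- `Λ_μ(z) = ∫ (1 - max(z,x)) dμ(x)`. -/
noncomputable def Lam (μ : Measure ℝ) (z : ℝ) : ℝ := ∫ x, (1 - max z x) ∂μ

/-- The second derivative of `-√(1 - z²)`. -/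
noncomputable def batWeight (z : ℝ) : ℝ := 1 / ((1 - z ^ 2) * √(1 - z ^ 2))

lemma measurable_batWeight : Measurable batWeight := by
  unfold batWeight; fun_prop

lemma batWeight_nonneg {z : ℝ} (hz : z ∈ Icc (0:ℝ) 1) : 0 ≤ batWeight z := by
  have : 0 ≤ 1 - z ^ 2 := by nlinarith [hz.1, hz.2]
  unfold batWeight; positivity

lemma hasDerivAt_div_sqrt_one_sub_sq {z : ℝ} (hz : z ∈ Ico (0:ℝ) 1) :
    HasDerivAt (fun z : ℝ => z / √(1 - z ^ 2)) (batWeight z) z := by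
  have h : 0 < 1 - z ^ 2 := by nlinarith [hz.1, hz.2]
  have hs : 0 < √(1 - z ^ 2) := Real.sqrt_pos.2 h
  have hq := Real.sq_sqrt h.le
  have h1 : HasDerivAt (fun z : ℝ => 1 - z ^ 2) (-(2 * z)) z := by
    simpa using (hasDerivAt_pow 2 z).const_sub 1
  refine ((hasDerivAt_id z).fun_div (h1.sqrt h.ne') hs.ne').congr_deriv ?_
  unfold batWeight
  simp only [id]
  set s := √(1 - z ^ 2)
  rw [← hq]
  field_simp
  linarith

lemma hasDerivAt_neg_sqrt_ratio {z : ℝ} (hz : z ∈ Ico (0:ℝ) 1) :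
    HasDerivAt (fun z : ℝ => -√((1 - z) / (1 + z))) (batWeight z * (1 - z)) z := by
  have h0 : 0 < 1 - z := by linarith [hz.2]
  have h2 : 0 < 1 + z := by linarith [hz.1]
  have h : 0 < (1 - z) / (1 + z) := by positivity
  have h1 : HasDerivAt (fun z : ℝ => (1 - z) / (1 + z))
      (((-1) * (1 + z) - (1 - z) * 1) / (1 + z) ^ 2) z :=
    ((hasDerivAt_id z).const_sub 1).fun_div ((hasDerivAt_id z).const_add 1) h2.ne'
  refine (h1.sqrt h.ne').fun_neg.congr_deriv ?_
  have e1 : 1 - z ^ 2 = (1 - z) * (1 + z) := by ring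
  unfold batWeight
  rw [e1, Real.sqrt_mul h0.le, Real.sqrt_div h0.le]
  have ha : 0 < √(1 - z) := Real.sqrt_pos.2 h0
  have hb : 0 < √(1 + z) := Real.sqrt_pos.2 h2
  have hb' := Real.sq_sqrt h2.le
  field_simp
  linarith

lemma integral_batWeight_zero_left {x : ℝ} (hx : x ∈ Ico (0:ℝ) 1) :
    IntervalIntegrable batWeight volume 0 x ∧
      ∫ z in (0:ℝ)..x, batWeight z = x / √(1 - x ^ 2) := by
  have hsub : ∀ z ∈ Icc (0:ℝ) x, z ∈ Ico (0:ℝ) 1 := fun z hz => ⟨hz.1, hz.2.trans_lt hx.2⟩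
  have hc : ContinuousOn (fun z : ℝ => z / √(1 - z ^ 2)) (Icc 0 x) := fun z hz =>
    (hasDerivAt_div_sqrt_one_sub_sq (hsub z hz)).continuousAt.continuousWithinAt
  have hd : ∀ z ∈ Ioo (0:ℝ) x, HasDerivAt (fun z : ℝ => z / √(1 - z ^ 2)) (batWeight z) z :=
    fun z hz => hasDerivAt_div_sqrt_one_sub_sq (hsub z (Ioo_subset_Icc_self hz))
  have hi : IntervalIntegrable batWeight volume 0 x :=
    (intervalIntegrable_iff_integrableOn_Ioc_of_le hx.1).2
      (intervalIntegral.integrableOn_deriv_of_nonneg hc hd fun z hz =>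
        batWeight_nonneg (Ico_subset_Icc_self (hsub z (Ioo_subset_Icc_self hz))))
  refine ⟨hi, ?_⟩
  rw [intervalIntegral.integral_eq_sub_of_hasDerivAt_of_le hx.1 hc hd hi]
  simp

lemma integral_batWeight_mul_one_right {x : ℝ} (hx : x ∈ Ico (0:ℝ) 1) :
    IntervalIntegrable (fun z => batWeight z * (1 - z)) volume x 1 ∧
      ∫ z in x..1, batWeight z * (1 - z) = √((1 - x) / (1 + x)) := by
  have hc : ContinuousOn (fun z : ℝ => -√((1 - z) / (1 + z))) (Icc x 1) := by
    refine (ContinuousOn.sqrt (ContinuousOn.div (by fun_prop) (by fun_prop) ?_)).neg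
    intro z hz
    linarith [hx.1, hz.1]
  have hd : ∀ z ∈ Ioo x 1, HasDerivAt (fun z : ℝ => -√((1 - z) / (1 + z)))
      (batWeight z * (1 - z)) z :=
    fun z hz => hasDerivAt_neg_sqrt_ratio ⟨hx.1.trans hz.1.le, hz.2⟩
  have hi : IntervalIntegrable (fun z => batWeight z * (1 - z)) volume x 1 :=
    (intervalIntegrable_iff_integrableOn_Ioc_of_le hx.2.le).2
      (intervalIntegral.integrableOn_deriv_of_nonneg hc hd fun z hz =>
        mul_nonneg (batWeight_nonneg ⟨hx.1.trans hz.1.le, hz.2.le⟩) (by linarith [hz.2]))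
  refine ⟨hi, ?_⟩
  rw [intervalIntegral.integral_eq_sub_of_hasDerivAt_of_le hx.2.le hc hd hi]
  simp

lemma integral_batWeight_mul_one_sub_max {x : ℝ} (hx : x ∈ Icc (0:ℝ) 1) :
    IntervalIntegrable (fun z => batWeight z * (1 - max z x)) volume 0 1 ∧
      ∫ z in (0:ℝ)..1, batWeight z * (1 - max z x) = √(1 - x ^ 2) := by
  rcases hx.2.eq_or_lt with rfl | hx1
  · have h0 : EqOn (fun _ => (0:ℝ)) (fun z => batWeight z * (1 - max z 1)) (uIoc 0 1) := by
      intro z hz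
      rw [uIoc_of_le zero_le_one] at hz
      simp [max_eq_right hz.2]
    refine ⟨(intervalIntegrable_congr h0).1 intervalIntegrable_const, ?_⟩
    rw [← intervalIntegral.integral_congr_ae (.of_forall h0)]
    simp
  · have hx' : x ∈ Ico (0:ℝ) 1 := ⟨hx.1, hx1⟩
    obtain ⟨hi1, he1⟩ := integral_batWeight_zero_left hx'
    obtain ⟨hi2, he2⟩ := integral_batWeight_mul_one_right hx'
    have h1 : EqOn (fun z => batWeight z * (1 - x)) (fun z => batWeight z * (1 - max z x))
        (uIoc 0 x) := by
      intro z hz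
      rw [uIoc_of_le hx.1] at hz
      simp only [max_eq_right hz.2]
    have h2 : EqOn (fun z => batWeight z * (1 - z)) (fun z => batWeight z * (1 - max z x))
        (uIoc x 1) := by
      intro z hz
      rw [uIoc_of_le hx.2] at hz
      simp only [max_eq_left hz.1.le]
    have hj1 := (intervalIntegrable_congr h1).1 (hi1.mul_const (1 - x))
    have hj2 := (intervalIntegrable_congr h2).1 hi2
    refine ⟨hj1.trans hj2, ?_⟩
    rw [← intervalIntegral.integral_add_adjacent_intervals hj1 hj2,
      ← intervalIntegral.integral_congr_ae (.of_forall h1), ← intervalIntegral.integral_congr_ae (.of_forall h2),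
      intervalIntegral.integral_mul_const, he1, he2]
    have g0 : 0 < 1 - x := by linarith
    have g2 : 0 < 1 + x := by linarith [hx.1]
    have e1 : 1 - x ^ 2 = (1 - x) * (1 + x) := by ring
    rw [e1, Real.sqrt_mul g0.le, Real.sqrt_div g0.le]
    have ha : 0 < √(1 - x) := Real.sqrt_pos.2 g0
    have hb : 0 < √(1 + x) := Real.sqrt_pos.2 g2
    have ha' := Real.sq_sqrt g0.le
    have hb' := Real.sq_sqrt g2.le
    field_simp
    rw [ha', hb']
    ring

lemma ofReal_sqrt_one_sub_sq_eq_lintegral {x : ℝ} (hx : x ∈ Icc (0:ℝ) 1) :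
    ENNReal.ofReal (√(1 - x ^ 2)) =
      ∫⁻ z in Ioc (0:ℝ) 1, ENNReal.ofReal (batWeight z * (1 - max z x)) := by
  obtain ⟨hi, he⟩ := integral_batWeight_mul_one_sub_max hx
  rw [← he, intervalIntegral.integral_of_le zero_le_one]
  refine ofReal_integral_eq_lintegral_ofReal
    ((intervalIntegrable_iff_integrableOn_Ioc_of_le zero_le_one).1 hi) ?_
  filter_upwards [ae_restrict_mem measurableSet_Ioc] with z hz
  exact mul_nonneg (batWeight_nonneg ⟨hz.1.le, hz.2⟩) (sub_nonneg.2 (max_le hz.2 hx.2))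

section

variable {μ : Measure ℝ} [IsProbabilityMeasure μ]

lemma integrable_one_sub_max (hμ : ∀ᵐ x ∂μ, x ∈ Icc (0:ℝ) 1) {z : ℝ} (hz : z ∈ Icc (0:ℝ) 1) :
    Integrable (fun x => 1 - max z x) μ := by
  refine Integrable.of_bound (by fun_prop) 1 ?_
  filter_upwards [hμ] with x hx
  rw [Real.norm_eq_abs, abs_of_nonneg (sub_nonneg.2 (max_le hz.2 hx.2))]
  linarith [hz.1, le_max_left z x]

lemma integrable_sqrt_one_sub_sq (μ : Measure ℝ) [IsProbabilityMeasure μ] :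
    Integrable (fun x : ℝ => √(1 - x ^ 2)) μ := by
  refine Integrable.of_bound (by fun_prop) 1 (Filter.Eventually.of_forall fun x => ?_)
  rw [Real.norm_eq_abs, abs_of_nonneg (Real.sqrt_nonneg _), Real.sqrt_le_one]
  nlinarith [sq_nonneg x]

lemma lintegral_sqrt_one_sub_sq_eq (hμ : ∀ᵐ x ∂μ, x ∈ Icc (0:ℝ) 1) :
    ∫⁻ x, ENNReal.ofReal (√(1 - x ^ 2)) ∂μ =
      ∫⁻ z in Ioc (0:ℝ) 1, ENNReal.ofReal (batWeight z * Lam μ z) := by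
  have hm : Measurable fun p : ℝ × ℝ => ENNReal.ofReal (batWeight p.2 * (1 - max p.2 p.1)) := by
    have := measurable_batWeight
    fun_prop
  rw [lintegral_congr_ae (hμ.mono fun x hx => ofReal_sqrt_one_sub_sq_eq_lintegral hx),
    lintegral_lintegral_swap hm.aemeasurable]
  refine setLIntegral_congr_fun measurableSet_Ioc fun z hz => ?_
  have hz' : z ∈ Icc (0:ℝ) 1 := Ioc_subset_Icc_self hz
  simp only [Lam]
  rw [← integral_const_mul]
  refine (ofReal_integral_eq_lintegral_ofReal
    ((integrable_one_sub_max hμ hz').const_mul _) ?_).symm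
  filter_upwards [hμ] with x hx
  exact mul_nonneg (batWeight_nonneg hz') (sub_nonneg.2 (max_le hz'.2 hx.2))

end

/-- A degraded channel has larger Battacharyya parameter
`𝔅(μ) = ∫ √(1-x²) dμ(x)` than the original channel. -/
theorem battacharyya_le_of_degraded
    (μ ν : Measure ℝ) (hμp : IsProbabilityMeasure μ) (hνp : IsProbabilityMeasure ν)
    (hμs : μ (Set.Icc (0:ℝ) 1)ᶜ = 0) (hνs : ν (Set.Icc (0:ℝ) 1)ᶜ = 0)
    (hdeg : ∀ z ∈ Set.Icc (0:ℝ) 1, Lam μ z ≤ Lam ν z) :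
    ∫ x, Real.sqrt (1 - x ^ 2) ∂μ ≤ ∫ x, Real.sqrt (1 - x ^ 2) ∂ν := by
  have hμ : ∀ᵐ x ∂μ, x ∈ Icc (0:ℝ) 1 := mem_ae_iff.2 hμs
  have hν : ∀ᵐ x ∂ν, x ∈ Icc (0:ℝ) 1 := mem_ae_iff.2 hνs
  have hnn : ∀ ρ : Measure ℝ, 0 ≤ᵐ[ρ] fun x : ℝ => √(1 - x ^ 2) := fun ρ =>
    Filter.Eventually.of_forall fun x => Real.sqrt_nonneg _
  rw [← ENNReal.ofReal_le_ofReal_iff (integral_nonneg fun x => Real.sqrt_nonneg _),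
    ofReal_integral_eq_lintegral_ofReal (integrable_sqrt_one_sub_sq μ) (hnn μ),
    ofReal_integral_eq_lintegral_ofReal (integrable_sqrt_one_sub_sq ν) (hnn ν),
    lintegral_sqrt_one_sub_sq_eq hμ, lintegral_sqrt_one_sub_sq_eq hν]
  refine setLIntegral_mono' measurableSet_Ioc fun z hz => ENNReal.ofReal_le_ofReal ?_
  exact mul_le_mul_of_nonneg_left (hdeg z (Ioc_subset_Icc_self hz))
    (batWeight_nonneg (Ioc_subset_Icc_self hz))
end

section
/- For every Borel probability measure μ on [0,1], the entropy functional admits the alternative representation ∫ h dμ = (1/ln 2) · ∫₀¹ Λ_μ(z)/(1-z²) dz, where h(x) = h₂((1-x)/2). -/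
open MeasureTheory Real Set

/-- Binary entropy function (Lean's `logb` satisfies `logb 2 0 = 0`,
so the convention `0·log₂ 0 = 0` is automatic). -/
noncomputable def h2 (p : ℝ) : ℝ := -p * Real.logb 2 p - (1 - p) * Real.logb 2 (1 - p)

/-- `h(x) = h₂((1-x)/2)`. -/
noncomputable def hD (x : ℝ) : ℝ := h2 ((1 - x) / 2)

/-- Multiplying by `log 2` turns the entropy function into natural logarithms. -/
lemma log_two_mul_hD {x : ℝ} (hx : x ∈ Icc (0:ℝ) 1) :
    Real.log 2 * hD x
      = Real.log 2 - (1 + x) / 2 * Real.log (1 + x) - (1 - x) / 2 * Real.log (1 - x) := by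
  have h2pos : Real.log 2 ≠ 0 := (Real.log_pos one_lt_two).ne'
  have hpos : (1 + x) ≠ 0 := by linarith [hx.1]
  have hcomp : 1 - (1 - x) / 2 = (1 + x) / 2 := by ring
  simp only [hD, h2, Real.logb, hcomp, Real.log_div hpos two_ne_zero]
  rcases eq_or_lt_of_le hx.2 with rfl | hlt
  · norm_num
  · rw [Real.log_div (by linarith) two_ne_zero]
    field_simp
    ring

lemma one_sub_max_div_nonneg {x z : ℝ} (hx : x ∈ Icc (0:ℝ) 1) (hz : z ∈ Icc (0:ℝ) 1) :
    0 ≤ (1 - max z x) / (1 - z ^ 2) :=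
  div_nonneg (sub_nonneg.2 (max_le hz.2 hx.2)) (by nlinarith [hz.1, hz.2])

lemma one_sub_max_div_le_one {x z : ℝ} (hz : z ∈ Icc (0:ℝ) 1) :
    (1 - max z x) / (1 - z ^ 2) ≤ 1 :=
  div_le_one_of_le₀ (by nlinarith [hz.1, hz.2, le_max_left z x]) (by nlinarith [hz.1, hz.2])

lemma integral_const_div_one_sub_sq {x : ℝ} (hx0 : 0 ≤ x) (hx1 : x < 1) (c : ℝ) :
    IntervalIntegrable (fun z : ℝ => c / (1 - z ^ 2)) volume 0 x ∧
      ∫ z in (0:ℝ)..x, c / (1 - z ^ 2)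
        = c / 2 * (Real.log (1 + x) - Real.log (1 - x)) := by
  have hne : ∀ z ∈ uIcc 0 x, 1 + z ≠ 0 ∧ 1 - z ≠ 0 := by
    intro z hz
    rw [uIcc_of_le hx0] at hz
    exact ⟨by linarith [hz.1], by linarith [hz.2]⟩
  have hne' : ∀ z ∈ uIcc 0 x, 1 - z ^ 2 ≠ 0 := by
    intro z hz
    have := mul_ne_zero (hne z hz).1 (hne z hz).2
    contrapose! this
    linarith
  have hint : IntervalIntegrable (fun z : ℝ => c / (1 - z ^ 2)) volume 0 x :=
    ContinuousOn.intervalIntegrable (ContinuousOn.div (by fun_prop) (by fun_prop) hne')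
  refine ⟨hint, ?_⟩
  rw [intervalIntegral.integral_eq_sub_of_hasDerivAt
    (f := fun z => c / 2 * (Real.log (1 + z) - Real.log (1 - z))) _ hint]
  · simp
  · intro z hz
    obtain ⟨h1, h2⟩ := hne z hz
    have h3 := hne' z hz
    refine (((((hasDerivAt_id z).const_add 1).log h1).sub
      (((hasDerivAt_id z).const_sub 1).log h2)).const_mul (c / 2)).congr_deriv ?_
    simp only [id]
    field_simp
    ring

lemma integral_one_div_one_add {x : ℝ} (hx0 : 0 ≤ x) (hx1 : x ≤ 1) :
    IntervalIntegrable (fun z : ℝ => 1 / (1 + z)) volume x 1 ∧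
      ∫ z in x..1, 1 / (1 + z) = Real.log 2 - Real.log (1 + x) := by
  have hne : ∀ z ∈ uIcc x 1, 1 + z ≠ 0 := by
    intro z hz
    rw [uIcc_of_le hx1] at hz
    linarith [hz.1]
  have hint : IntervalIntegrable (fun z : ℝ => 1 / (1 + z)) volume x 1 :=
    ContinuousOn.intervalIntegrable (ContinuousOn.div (by fun_prop) (by fun_prop) hne)
  refine ⟨hint, ?_⟩
  rw [intervalIntegral.integral_eq_sub_of_hasDerivAt (f := fun z => Real.log (1 + z)) _ hint]
  · norm_num
  · intro z hz
    exact ((hasDerivAt_id z).const_add 1).log (hne z hz)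

/-- The representation for a point mass at `x`. -/
lemma integral_one_sub_max_div {x : ℝ} (hx : x ∈ Icc (0:ℝ) 1) :
    ∫ z in (0:ℝ)..1, (1 - max z x) / (1 - z ^ 2) = Real.log 2 * hD x := by
  rw [log_two_mul_hD hx]
  rcases eq_or_lt_of_le hx.2 with rfl | hlt
  · rw [intervalIntegral.integral_congr (g := fun _ => (0:ℝ))]
    · norm_num
    · intro z hz
      rw [uIcc_of_le zero_le_one] at hz
      simp [max_eq_right hz.2]
  · obtain ⟨hi1, he1⟩ := integral_const_div_one_sub_sq hx.1 hlt (1 - x)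
    obtain ⟨hi2, he2⟩ := integral_one_div_one_add hx.1 hx.2
    have hl : EqOn (fun z => (1 - x) / (1 - z ^ 2))
        (fun z => (1 - max z x) / (1 - z ^ 2)) (uIoo 0 x) := by
      intro z hz
      rw [uIoo_of_le hx.1] at hz
      simp [max_eq_right hz.2.le]
    have hr : EqOn (fun z => 1 / (1 + z))
        (fun z => (1 - max z x) / (1 - z ^ 2)) (uIoo x 1) := by
      intro z hz
      rw [uIoo_of_le hx.2] at hz
      have h1 : 1 + z ≠ 0 := by linarith [hz.1, hx.1]
      have h2 : 1 - z ≠ 0 := by linarith [hz.2]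
      have h3 : 1 - z ^ 2 = (1 + z) * (1 - z) := by ring
      simp only [max_eq_left hz.1.le, h3]
      field_simp
    rw [← intervalIntegral.integral_add_adjacent_intervals (hi1.congr_uIoo hl)
      (hi2.congr_uIoo hr), ← intervalIntegral.integral_congr_uIoo hl,
      ← intervalIntegral.integral_congr_uIoo hr, he1, he2]
    ring

/-- The kernel `(1 - max z x) / (1 - z²)` is bounded, hence integrable, on the unit square. -/
lemma integrable_one_sub_max_div (μ : Measure ℝ) [IsFiniteMeasure μ]
    (hμ : ∀ᵐ x ∂μ, x ∈ Icc (0:ℝ) 1) :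
    Integrable (Function.uncurry fun x z : ℝ => (1 - max z x) / (1 - z ^ 2))
      (μ.prod (volume.restrict (Ioc 0 1))) := by
  have hmeas : Measurable (Function.uncurry fun x z : ℝ => (1 - max z x) / (1 - z ^ 2)) := by
    unfold Function.uncurry
    fun_prop
  refine Integrable.of_bound hmeas.aestronglyMeasurable 1 ?_
  have hx := Measure.quasiMeasurePreserving_fst (μ := μ)
    (ν := volume.restrict (Ioc (0:ℝ) 1)) |>.ae hμ
  have hz := Measure.quasiMeasurePreserving_snd (μ := μ)
    (ν := volume.restrict (Ioc (0:ℝ) 1)) |>.ae (ae_restrict_mem measurableSet_Ioc)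
  filter_upwards [hx, hz] with p hpx hpz
  have hpz' := Ioc_subset_Icc_self hpz
  rw [Function.uncurry, Real.norm_of_nonneg (one_sub_max_div_nonneg hpx hpz')]
  exact one_sub_max_div_le_one hpz'

/-- Alternative representation of the entropy functional:
`∫ h dμ = (1/ln 2) · ∫₀¹ Λ_μ(z)/(1-z²) dz`. -/
theorem entropy_eq_integral_Lam
    (μ : Measure ℝ) (hprob : IsProbabilityMeasure μ)
    (hsupp : μ (Set.Icc (0:ℝ) 1)ᶜ = 0) :
    ∫ x, hD x ∂μ = (1 / Real.log 2) * ∫ z in (0:ℝ)..1, Lam μ z / (1 - z ^ 2) := by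
  have hμ : ∀ᵐ x ∂μ, x ∈ Icc (0:ℝ) 1 := hsupp
  have h2pos : Real.log 2 ≠ 0 := (Real.log_pos one_lt_two).ne'
  have hswap := integral_integral_swap (integrable_one_sub_max_div μ hμ)
  have hleft : ∫ x, (∫ z in Ioc (0:ℝ) 1, (1 - max z x) / (1 - z ^ 2)) ∂μ
      = Real.log 2 * ∫ x, hD x ∂μ := by
    rw [← integral_const_mul]
    refine integral_congr_ae ?_
    filter_upwards [hμ] with x hx
    rw [← intervalIntegral.integral_of_le zero_le_one, integral_one_sub_max_div hx]
  simp only [hleft, integral_div] at hswap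
  rw [intervalIntegral.integral_of_le zero_le_one]
  simp only [Lam]
  rw [← hswap]
  field_simp
end

section
/- Fix c with 0 < c < 1 and let ε_bsc ∈ (0,1/2) solve 1 - h₂(ε_bsc) = c. Then 1 - c - 2ε_bsc ≥ 0, and the probability measure μ* = ((1-c-2ε_bsc)/(1-2ε_bsc))·δ₀ + (c/(1-2ε_bsc))·δ_{1-2ε_bsc} on [0,1] satisfies: (a) Λ_{μ*}(z) = Λ*(z) for every z ∈ [0,1]; and (b) ∫ h dμ* = 1 - c²/(1-2ε_bsc). In other words, μ* is the |D|-distribution of the least degraded channel, and its capacity is c²/(1-2ε_bsc). -/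
open MeasureTheory Real Set

/-- `Λ*(z)`, characterizing the least degraded channel. -/
noncomputable def Lstar (c ε z : ℝ) : ℝ :=
  if z < 1 - 2 * ε then (1 - c) - ((1 - c - 2 * ε) / (1 - 2 * ε)) * z else 1 - z

theorem h2_eq_binEntropy_div (p : ℝ) : h2 p = binEntropy p / log 2 := by
  simp only [h2, logb, binEntropy_eq_negMulLog_add_negMulLog_one_sub, negMulLog]
  ring

theorem h2_half : h2 (1 / 2) = 1 := by
  rw [h2_eq_binEntropy_div, one_div, binEntropy_two_inv, div_self (log_pos one_lt_two).ne']

/-- By concavity, binary entropy lies above its chord on `[0, 1/2]`. -/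
theorem two_mul_le_h2 {p : ℝ} (hp0 : 0 ≤ p) (hp1 : p ≤ 1 / 2) : 2 * p ≤ h2 p := by
  rw [h2_eq_binEntropy_div, le_div_iff₀ (log_pos one_lt_two)]
  have h := strictConcave_binEntropy.concaveOn.2 (left_mem_Icc.2 zero_le_one)
    (show (2⁻¹ : ℝ) ∈ Icc 0 1 by constructor <;> norm_num)
    (show 0 ≤ 1 - 2 * p by linarith) (show 0 ≤ 2 * p by linarith) (by ring)
  simp only [smul_eq_mul, binEntropy_zero, binEntropy_two_inv, mul_zero, zero_add] at h
  rwa [show 2 * p * 2⁻¹ = p by ring] at h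

theorem integral_ofReal_smul_dirac_add_ofReal_smul_dirac {α : Type*} [MeasurableSpace α]
    [MeasurableSingletonClass α] {a b : ℝ} (ha : 0 ≤ a) (hb : 0 ≤ b) (x y : α) (f : α → ℝ) :
    ∫ t, f t ∂(ENNReal.ofReal a • Measure.dirac x + ENNReal.ofReal b • Measure.dirac y) =
      a * f x + b * f y := by
  rw [integral_add_measure
    ((integrable_dirac enorm_lt_top).smul_measure ENNReal.ofReal_ne_top)
    ((integrable_dirac enorm_lt_top).smul_measure ENNReal.ofReal_ne_top)]
  simp [integral_smul_measure, ENNReal.toReal_ofReal, ha, hb]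

theorem isProbabilityMeasure_ofReal_smul_dirac_add_ofReal_smul_dirac {α : Type*}
    [MeasurableSpace α] {a b : ℝ} (ha : 0 ≤ a) (hb : 0 ≤ b) (hab : a + b = 1) (x y : α) :
    IsProbabilityMeasure
      (ENNReal.ofReal a • Measure.dirac x + ENNReal.ofReal b • Measure.dirac y) :=
  ⟨by simp [← ENNReal.ofReal_add ha hb, hab]⟩

/-- The measure `μ* = ((1-c-2ε)/(1-2ε))·δ₀ + (c/(1-2ε))·δ_{1-2ε}` is the
|D|-distribution of the least degraded channel: it is a probability measure on
`[0,1]` whose `Λ`-function is `Λ*`, and its capacity is `c²/(1-2ε)`. -/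
theorem least_degraded_channel
    (c ε : ℝ) (hc0 : 0 < c) (hc1 : c < 1)
    (hε0 : 0 < ε) (hε1 : ε < 1 / 2) (hεc : 1 - h2 ε = c) :
    0 ≤ 1 - c - 2 * ε ∧
      IsProbabilityMeasure
        (ENNReal.ofReal ((1 - c - 2 * ε) / (1 - 2 * ε)) • Measure.dirac (0:ℝ) +
          ENNReal.ofReal (c / (1 - 2 * ε)) • Measure.dirac (1 - 2 * ε)) ∧
      (∀ z ∈ Set.Icc (0:ℝ) 1,
        Lam (ENNReal.ofReal ((1 - c - 2 * ε) / (1 - 2 * ε)) • Measure.dirac (0:ℝ) +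
            ENNReal.ofReal (c / (1 - 2 * ε)) • Measure.dirac (1 - 2 * ε)) z =
          Lstar c ε z) ∧
      (∫ x, hD x
          ∂(ENNReal.ofReal ((1 - c - 2 * ε) / (1 - 2 * ε)) • Measure.dirac (0:ℝ) +
            ENNReal.ofReal (c / (1 - 2 * ε)) • Measure.dirac (1 - 2 * ε))) =
        1 - c ^ 2 / (1 - 2 * ε) := by
  have hd : 0 < 1 - 2 * ε := by linarith
  have hnum : 0 ≤ 1 - c - 2 * ε := by linarith [two_mul_le_h2 hε0.le hε1.le]
  have ha : 0 ≤ (1 - c - 2 * ε) / (1 - 2 * ε) := div_nonneg hnum hd.le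
  have hb : 0 ≤ c / (1 - 2 * ε) := div_nonneg hc0.le hd.le
  refine ⟨hnum, isProbabilityMeasure_ofReal_smul_dirac_add_ofReal_smul_dirac ha hb ?_ _ _,
    fun z hz => ?_, ?_⟩
  · field_simp
    ring
  · rw [Lam, integral_ofReal_smul_dirac_add_ofReal_smul_dirac ha hb, Lstar, max_eq_left hz.1]
    split_ifs with h
    · rw [max_eq_right h.le]
      field_simp
      ring
    · rw [max_eq_left (not_lt.mp h)]
      field_simp
      ring
  · rw [integral_ofReal_smul_dirac_add_ofReal_smul_dirac ha hb, hD, hD, sub_zero, h2_half,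
      show (1 - (1 - 2 * ε)) / 2 = ε by ring, show h2 ε = 1 - c by linarith]
    field_simp
    ring
end

section
/- Let 0 ≤ x₋ < x₊ ≤ 1 and let α₋ > 0, α₊ > 0. Then there exists a unique x̃ ∈ (x₋, x₊) such that α₋·h(x₋) + α₊·h(x₊) = (α₋+α₊)·h(x̃), and for this x̃ one has the strict inequality α₋·(1-x₋) + α₊·(1-x₊) > (α₋+α₊)·(1-x̃). (Merging two probability masses into one while preserving the entropy functional strictly decreases the Λ-functional contribution.) -/
open MeasureTheory Real Set

theorem hD_eq_binEntropy_div (x : ℝ) : hD x = binEntropy ((1 - x) / 2) / log 2 := by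
  simp only [hD, h2, Real.logb, binEntropy, Real.log_inv]
  ring

theorem continuous_hD : Continuous hD := by
  rw [funext hD_eq_binEntropy_div]
  fun_prop

theorem strictAntiOn_hD : StrictAntiOn hD (Icc 0 1) := by
  intro x hx y hy hxy
  rw [hD_eq_binEntropy_div, hD_eq_binEntropy_div]
  have hlog : 0 < log 2 := Real.log_pos one_lt_two
  refine div_lt_div_of_pos_right (binEntropy_strictMonoOn ?_ ?_ (by linarith)) hlog
  · constructor <;> linarith [hy.1, hy.2]
  · constructor <;> linarith [hx.1, hx.2]

theorem strictConcaveOn_hD : StrictConcaveOn ℝ (Icc 0 1) hD := by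
  refine ⟨convex_Icc 0 1, fun x hx y hy hxy a b ha hb hab => ?_⟩
  have hlog : 0 < log 2 := Real.log_pos one_lt_two
  have key := strictConcave_binEntropy.2 (x := (1 - x) / 2) (y := (1 - y) / 2)
    (by constructor <;> linarith [hx.1, hx.2]) (by constructor <;> linarith [hy.1, hy.2])
    (fun h => hxy (by linarith)) ha hb hab
  have harg : a • ((1 - x) / 2) + b • ((1 - y) / 2) = (1 - (a • x + b • y)) / 2 := by
    simp only [smul_eq_mul]
    linear_combination hab / 2
  rw [harg] at key
  simp only [hD_eq_binEntropy_div, smul_eq_mul] at key ⊢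
  rw [← mul_div_assoc, ← mul_div_assoc, ← add_div]
  exact div_lt_div_of_pos_right key hlog

/-- Merging two probability masses into one while preserving the entropy
functional: there is a unique `x̃ ∈ (x₋, x₊)` with
`α₋·h(x₋) + α₊·h(x₊) = (α₋+α₊)·h(x̃)`, and for it
`α₋·(1-x₋) + α₊·(1-x₊) > (α₋+α₊)·(1-x̃)`. -/
theorem mass_merging
    (xm xp am ap : ℝ) (hxm : 0 ≤ xm) (hlt : xm < xp) (hxp : xp ≤ 1)
    (ham : 0 < am) (hap : 0 < ap) :
    (∃! xt : ℝ, xt ∈ Set.Ioo xm xp ∧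
        am * hD xm + ap * hD xp = (am + ap) * hD xt) ∧
      (∀ xt ∈ Set.Ioo xm xp,
        am * hD xm + ap * hD xp = (am + ap) * hD xt →
        am * (1 - xm) + ap * (1 - xp) > (am + ap) * (1 - xt)) := by
  have hs : 0 < am + ap := add_pos ham hap
  have hm : xm ∈ Icc (0 : ℝ) 1 := ⟨hxm, by linarith⟩
  have hp : xp ∈ Icc (0 : ℝ) 1 := ⟨by linarith, hxp⟩
  have hsub : ∀ x ∈ Ioo xm xp, x ∈ Icc (0 : ℝ) 1 := fun x hx =>
    ⟨by linarith [hx.1], by linarith [hx.2]⟩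
  have hanti := strictAntiOn_hD hm hp hlt
  refine ⟨?_, fun x hx hEq => ?_⟩
  · have hmem : (am * hD xm + ap * hD xp) / (am + ap) ∈ Ioo (hD xp) (hD xm) := by
      constructor
      · rw [lt_div_iff₀ hs]
        nlinarith
      · rw [div_lt_iff₀ hs]
        nlinarith
    obtain ⟨x, hx, hfx⟩ := intermediate_value_Ioo' hlt.le continuous_hD.continuousOn hmem
    have hEq : am * hD xm + ap * hD xp = (am + ap) * hD x := by
      rw [hfx]
      field_simp
    refine ⟨x, ⟨hx, hEq⟩, fun y ⟨hy, hyEq⟩ => ?_⟩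
    exact strictAntiOn_hD.injOn (hsub y hy) (hsub x hx)
      (mul_left_cancel₀ hs.ne' (hyEq.symm.trans hEq))
  · have hab : am / (am + ap) + ap / (am + ap) = 1 := by field_simp
    have hconc := strictConcaveOn_hD.2 hm hp hlt.ne (div_pos ham hs) (div_pos hap hs) hab
    have hmean := strictConcaveOn_hD.1 hm hp (div_pos ham hs).le (div_pos hap hs).le hab
    have hval : (am / (am + ap)) • hD xm + (ap / (am + ap)) • hD xp = hD x := by
      simp only [smul_eq_mul]
      field_simp
      linarith
    rw [hval] at hconc
    have hlt' := (strictAntiOn_hD.lt_iff_gt (hsub x hx) hmean).1 hconc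
    simp only [smul_eq_mul] at hlt'
    have hmul := mul_lt_mul_of_pos_left hlt' hs
    have hexp : (am + ap) * (am / (am + ap) * xm + ap / (am + ap) * xp) =
        am * xm + ap * xp := by field_simp
    linarith
end
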